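/- arXiv:2008.13356 — 3 statements merged into one kernel-verified Lean document; each statement's English description precedes it below -/
import Mathlib

section
/- Strong bisimilarity fails to be a congruence for the process algebra with global variables: with data domain D = {0,1}, a single global variable v, an action a, and valuation V with V(v) = 0, the process expressions P = (v=0)→a.δ and Q = a.δ satisfy that ⟨P,V⟩ and ⟨Q,V⟩ are strongly bisimilar, yet for R = assign(v,1).δ the states ⟨P∥R,V⟩ and ⟨Q∥R,V⟩ are not strongly bisimilar. -/
namespace GlobalVars

open scoped Classical

/-! ## The process algebra with global variables -/

/-- Transition labels: actions and assignments `assign(v,d)`. -/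
inductive Label (D Var Act : Type) : Type
  | act : Act → Label D Var Act
  | assign : Var → D → Label D Var Act

/-- Process expressions of the process algebra with global variables. -/
inductive PExp (D Var Act PN : Type) : Type
  | pre : Label D Var Act → PExp D Var Act PN → PExp D Var Act PN
  | delta : PExp D Var Act PN
  | choice : PExp D Var Act PN → PExp D Var Act PN → PExp D Var Act PN
  | par : PExp D Var Act PN → PExp D Var Act PN → PExp D Var Act PN
  | encaps : Set Act → PExp D Var Act PN → PExp D Var Act PN
  | name : PN → PExp D Var Act PN
  | cond : Var → D → PExp D Var Act PN → PExp D Var Act PN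

/-- Valuations of the global variables. -/
abbrev Valuation (D Var : Type) := Var → D

variable {D Var Act PN : Type}

/-- Every occurrence of a process name is in the scope of an action prefix. -/
def GuardedExp : PExp D Var Act PN → Prop
  | .pre _ _ => True
  | .delta => True
  | .choice P Q => GuardedExp P ∧ GuardedExp Q
  | .par P Q => GuardedExp P ∧ GuardedExp Q
  | .encaps _ P => GuardedExp P
  | .name _ => False
  | .cond _ _ P => GuardedExp P

/-- A guarded recursive specification. -/
def Guarded (spec : PN → PExp D Var Act PN) : Prop := ∀ X, GuardedExp (spec X)

/-- A label is not blocked by the encapsulation set `B ⊆ Act`. -/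
def Label.allowedBy (B : Set Act) : Label D Var Act → Prop
  | .act a => a ∉ B
  | .assign _ _ => True

/-- A partial binary communication function on actions. -/
def CommFun (Act : Type) : Type := Act → Act → Option Act

/-- Commutativity of the communication function. -/
def CommFun.Commutative (γ : CommFun Act) : Prop := ∀ a b, γ a b = γ b a

/-- Associativity of the communication function. -/
def CommFun.Associative (γ : CommFun Act) : Prop :=
  ∀ a b c, (γ a b).bind (fun x => γ x c) = (γ b c).bind (fun x => γ a x)

/-- Only handshaking communication: results of communications do not communicate further. -/
def CommFun.Handshaking (γ : CommFun Act) : Prop :=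
  ∀ a b c, γ a b = some c → ∀ d, γ c d = none

/-- The structural operational semantics of the process algebra with global variables. -/
inductive Trans [DecidableEq Var] (spec : PN → PExp D Var Act PN) (γ : CommFun Act) :
    PExp D Var Act PN → Valuation D Var → Label D Var Act →
    PExp D Var Act PN → Valuation D Var → Prop
  | pref (a : Act) (P : PExp D Var Act PN) (V : Valuation D Var) :
      Trans spec γ (.pre (.act a) P) V (.act a) P V
  | asgn (v : Var) (d : D) (P : PExp D Var Act PN) (V : Valuation D Var) :
      Trans spec γ (.pre (.assign v d) P) V (.assign v d) P (Function.update V v d)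
  | cond (v : Var) (d : D) (P : PExp D Var Act PN) (V : Valuation D Var) (l : Label D Var Act)
      (P' : PExp D Var Act PN) (V' : Valuation D Var) :
      V v = d → Trans spec γ P V l P' V' → Trans spec γ (.cond v d P) V l P' V'
  | recursion (X : PN) (V : Valuation D Var) (l : Label D Var Act) (P' : PExp D Var Act PN)
      (V' : Valuation D Var) :
      Trans spec γ (spec X) V l P' V' → Trans spec γ (.name X) V l P' V'
  | sumL (P Q : PExp D Var Act PN) (V : Valuation D Var) (l : Label D Var Act)
      (P' : PExp D Var Act PN) (V' : Valuation D Var) :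
      Trans spec γ P V l P' V' → Trans spec γ (.choice P Q) V l P' V'
  | sumR (P Q : PExp D Var Act PN) (V : Valuation D Var) (l : Label D Var Act)
      (Q' : PExp D Var Act PN) (V' : Valuation D Var) :
      Trans spec γ Q V l Q' V' → Trans spec γ (.choice P Q) V l Q' V'
  | parL (P Q : PExp D Var Act PN) (V : Valuation D Var) (l : Label D Var Act)
      (P' : PExp D Var Act PN) (V' : Valuation D Var) :
      Trans spec γ P V l P' V' → Trans spec γ (.par P Q) V l (.par P' Q) V'
  | parR (P Q : PExp D Var Act PN) (V : Valuation D Var) (l : Label D Var Act)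
      (Q' : PExp D Var Act PN) (V' : Valuation D Var) :
      Trans spec γ Q V l Q' V' → Trans spec γ (.par P Q) V l (.par P Q') V'
  | comm (P Q : PExp D Var Act PN) (V : Valuation D Var) (a b c : Act)
      (P' Q' : PExp D Var Act PN) :
      γ a b = some c → Trans spec γ P V (.act a) P' V → Trans spec γ Q V (.act b) Q' V →
      Trans spec γ (.par P Q) V (.act c) (.par P' Q') V
  | encaps (B : Set Act) (P : PExp D Var Act PN) (V : Valuation D Var) (l : Label D Var Act)
      (P' : PExp D Var Act PN) (V' : Valuation D Var) :
      l.allowedBy B → Trans spec γ P V l P' V' →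
      Trans spec γ (.encaps B P) V l (.encaps B P') V'

/-- States of the induced labelled transition system. -/
abbrev GState (D Var Act PN : Type) := PExp D Var Act PN × Valuation D Var

/-- The transition relation on states. -/
def STrans [DecidableEq Var] (spec : PN → PExp D Var Act PN) (γ : CommFun Act) :
    GState D Var Act PN → Label D Var Act → GState D Var Act PN → Prop :=
  fun s l s' => Trans spec γ s.1 s.2 l s'.1 s'.2

/-! ## Bisimulations -/

/-- A strong bisimulation on an LTS with states `S` and labels `L`. -/
def IsBisim {S L : Type} (tr : S → L → S → Prop) (R : S → S → Prop) : Prop :=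
  ∀ s t, R s t → ∀ l : L,
    (∀ s', tr s l s' → ∃ t', tr t l t' ∧ R s' t') ∧
    (∀ t', tr t l t' → ∃ s', tr s l s' ∧ R s' t')

/-- Strong bisimilarity. -/
def Bisimilar {S L : Type} (tr : S → L → S → Prop) (s t : S) : Prop :=
  ∃ R, IsBisim tr R ∧ R s t

/-- A stateless bisimulation on process expressions. -/
def IsStatelessBisim [DecidableEq Var] (spec : PN → PExp D Var Act PN) (γ : CommFun Act)
    (R : PExp D Var Act PN → PExp D Var Act PN → Prop) : Prop :=
  ∀ P Q, R P Q → ∀ (l : Label D Var Act) (V V' : Valuation D Var),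
    (∀ P', Trans spec γ P V l P' V' → ∃ Q', Trans spec γ Q V l Q' V' ∧ R P' Q') ∧
    (∀ Q', Trans spec γ Q V l Q' V' → ∃ P', Trans spec γ P V l P' V' ∧ R P' Q')

/-- Stateless bisimilarity of process expressions. -/
def StatelessBisimilar [DecidableEq Var] (spec : PN → PExp D Var Act PN) (γ : CommFun Act)
    (P Q : PExp D Var Act PN) : Prop :=
  ∃ R, IsStatelessBisim spec γ R ∧ R P Q

/-- A state-based bisimulation on states. -/
def IsStateBasedBisim [DecidableEq Var] (spec : PN → PExp D Var Act PN) (γ : CommFun Act)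
    (R : GState D Var Act PN → GState D Var Act PN → Prop) : Prop :=
  ∀ (P : PExp D Var Act PN) (V₁ : Valuation D Var) (Q : PExp D Var Act PN)
    (V₂ : Valuation D Var), R (P, V₁) (Q, V₂) →
    V₁ = V₂ ∧ ∀ (l : Label D Var Act) (V' : Valuation D Var),
      (∀ P', Trans spec γ P V₁ l P' V' →
        ∃ Q', Trans spec γ Q V₂ l Q' V' ∧ R (P', V') (Q', V')) ∧
      (∀ Q', Trans spec γ Q V₂ l Q' V' →
        ∃ P', Trans spec γ P V₁ l P' V' ∧ R (P', V') (Q', V'))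

/-- State-based bisimilarity of states. -/
def StateBasedBisimilar [DecidableEq Var] (spec : PN → PExp D Var Act PN) (γ : CommFun Act)
    (s t : GState D Var Act PN) : Prop :=
  ∃ R, IsStateBasedBisim spec γ R ∧ R s t

/-! ## Reachability and image-finiteness -/

/-- Reachability of states in an arbitrary LTS. -/
def ReachableState {S L : Type} (tr : S → L → S → Prop) : S → S → Prop :=
  Relation.ReflTransGen (fun s s' => ∃ l, tr s l s')

/-- Reachability of process expressions (via transitions for some valuations). -/
def ReachableProc [DecidableEq Var] (spec : PN → PExp D Var Act PN) (γ : CommFun Act) :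
    PExp D Var Act PN → PExp D Var Act PN → Prop :=
  Relation.ReflTransGen
    (fun P P' => ∃ (V : Valuation D Var) (l : Label D Var Act) (V' : Valuation D Var),
      Trans spec γ P V l P' V')

/-- Image-finiteness of a state of an arbitrary LTS. -/
def ImageFiniteState {S L : Type} (tr : S → L → S → Prop) (s : S) : Prop :=
  ∀ l : L, {s' | tr s l s'}.Finite

/-- Image-finiteness of a process expression. -/
def ImageFiniteProc [DecidableEq Var] (spec : PN → PExp D Var Act PN) (γ : CommFun Act)
    (P : PExp D Var Act PN) : Prop :=
  ∀ P', ReachableProc spec γ P P' → ∀ V : Valuation D Var,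
    ImageFiniteState (STrans spec γ) (P', V)

/-! ## Hennessy–Milner logics -/

/-- Plain Hennessy–Milner logic over a type `L` of transition labels
(the modalities carry nonempty finite sets of labels). -/
inductive HMLb (L : Type) : Type
  | tt : HMLb L
  | ff : HMLb L
  | neg : HMLb L → HMLb L
  | conj : HMLb L → HMLb L → HMLb L
  | disj : HMLb L → HMLb L → HMLb L
  | dia : (T : Set L) → T.Finite → T.Nonempty → HMLb L → HMLb L
  | box : (T : Set L) → T.Finite → T.Nonempty → HMLb L → HMLb L

/-- Satisfaction of plain HML in a state of an LTS. -/
def HMLb.Sat {S L : Type} (tr : S → L → S → Prop) : HMLb L → S → Prop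
  | .tt, _ => True
  | .ff, _ => False
  | .neg φ, s => ¬ HMLb.Sat tr φ s
  | .conj φ ψ, s => HMLb.Sat tr φ s ∧ HMLb.Sat tr ψ s
  | .disj φ ψ, s => HMLb.Sat tr φ s ∨ HMLb.Sat tr ψ s
  | .dia T _ _ φ, s => ∃ l ∈ T, ∃ s', tr s l s' ∧ HMLb.Sat tr φ s'
  | .box T _ _ φ, s => ∀ l ∈ T, ∀ s', tr s l s' → HMLb.Sat tr φ s'

/-- `HML^{check}`: HML extended with the check operator `(v = e)`. -/
inductive HMLc (D Var L : Type) : Type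
  | tt : HMLc D Var L
  | ff : HMLc D Var L
  | check : Var → D → HMLc D Var L
  | neg : HMLc D Var L → HMLc D Var L
  | conj : HMLc D Var L → HMLc D Var L → HMLc D Var L
  | disj : HMLc D Var L → HMLc D Var L → HMLc D Var L
  | dia : (T : Set L) → T.Finite → T.Nonempty → HMLc D Var L → HMLc D Var L
  | box : (T : Set L) → T.Finite → T.Nonempty → HMLc D Var L → HMLc D Var L

/-- Satisfaction of `HML^{check}` in a state consisting of a process and a valuation. -/
def HMLc.Sat {Pr L : Type}
    (tr : (Pr × Valuation D Var) → L → (Pr × Valuation D Var) → Prop) :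
    HMLc D Var L → (Pr × Valuation D Var) → Prop
  | .tt, _ => True
  | .ff, _ => False
  | .check v e, s => s.2 v = e
  | .neg φ, s => ¬ HMLc.Sat tr φ s
  | .conj φ ψ, s => HMLc.Sat tr φ s ∧ HMLc.Sat tr ψ s
  | .disj φ ψ, s => HMLc.Sat tr φ s ∨ HMLc.Sat tr ψ s
  | .dia T _ _ φ, s => ∃ l ∈ T, ∃ s', tr s l s' ∧ HMLc.Sat tr φ s'
  | .box T _ _ φ, s => ∀ l ∈ T, ∀ s', tr s l s' → HMLc.Sat tr φ s'

/-- `HML^{check+set}`: HML extended with the check operator `(v = e)` and the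
set operator `↓(v := e)`. -/
inductive HMLcs (D Var L : Type) : Type
  | tt : HMLcs D Var L
  | ff : HMLcs D Var L
  | check : Var → D → HMLcs D Var L
  | neg : HMLcs D Var L → HMLcs D Var L
  | conj : HMLcs D Var L → HMLcs D Var L → HMLcs D Var L
  | disj : HMLcs D Var L → HMLcs D Var L → HMLcs D Var L
  | dia : (T : Set L) → T.Finite → T.Nonempty → HMLcs D Var L → HMLcs D Var L
  | box : (T : Set L) → T.Finite → T.Nonempty → HMLcs D Var L → HMLcs D Var L
  | set : Var → D → HMLcs D Var L → HMLcs D Var L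

/-- Satisfaction of `HML^{check+set}` in a state consisting of a process and a valuation. -/
def HMLcs.Sat {Pr L : Type} [DecidableEq Var]
    (tr : (Pr × Valuation D Var) → L → (Pr × Valuation D Var) → Prop) :
    HMLcs D Var L → (Pr × Valuation D Var) → Prop
  | .tt, _ => True
  | .ff, _ => False
  | .check v e, s => s.2 v = e
  | .neg φ, s => ¬ HMLcs.Sat tr φ s
  | .conj φ ψ, s => HMLcs.Sat tr φ s ∧ HMLcs.Sat tr ψ s
  | .disj φ ψ, s => HMLcs.Sat tr φ s ∨ HMLcs.Sat tr ψ s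
  | .dia T _ _ φ, s => ∃ l ∈ T, ∃ s', tr s l s' ∧ HMLcs.Sat tr φ s'
  | .box T _ _ φ, s => ∀ l ∈ T, ∀ s', tr s l s' → HMLcs.Sat tr φ s'
  | .set v e φ, s => HMLcs.Sat tr φ (s.1, Function.update s.2 v e)

/-! ## The mCRL2 fragment -/

/-- Action labels of the mCRL2 fragment used for the translation. -/
inductive MAct (D Var Act : Type) : Type
  | act : Act → MAct D Var Act
  | checkP : D → Bool → MAct D Var Act
  | checkG : D → Bool → MAct D Var Act
  | check : D → Bool → MAct D Var Act
  | assignP : Var → D → MAct D Var Act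
  | assignG : Var → D → MAct D Var Act
  | assign : Var → D → MAct D Var Act
  | value : Var → D → MAct D Var Act

/-- Action names of the mCRL2 fragment. -/
inductive MName (Act : Type) : Type
  | act : Act → MName Act
  | checkP : MName Act
  | checkG : MName Act
  | check : MName Act
  | assignP : MName Act
  | assignG : MName Act
  | assign : MName Act
  | value : MName Act

/-- The name of an action label. -/
def MAct.name : MAct D Var Act → MName Act
  | .act a => .act a
  | .checkP _ _ => .checkP
  | .checkG _ _ => .checkG
  | .check _ _ => .check
  | .assignP _ _ => .assignP
  | .assignG _ _ => .assignG
  | .assign _ _ => .assign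
  | .value _ _ => .value

/-- mCRL2 process expressions of the fragment needed for the translation.
Multi-action prefixes carry semantic multi-actions (finite multisets of action labels);
`comm` is the communication operator `Γ_{C_{Gγ}}`. -/
inductive MProc (D Var Act N : Type) : Type
  | pre : Multiset (MAct D Var Act) → MProc D Var Act N → MProc D Var Act N
  | delta : MProc D Var Act N
  | choice : MProc D Var Act N → MProc D Var Act N → MProc D Var Act N
  | par : MProc D Var Act N → MProc D Var Act N → MProc D Var Act N
  | allow : Set (Multiset (MName Act)) → MProc D Var Act N → MProc D Var Act N
  | name : N → MProc D Var Act N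
  | sum : (D → MProc D Var Act N) → MProc D Var Act N
  | hide : Set (MName Act) → MProc D Var Act N → MProc D Var Act N
  | comm : MProc D Var Act N → MProc D Var Act N

/-- The effect of hiding the action names in `I` on a semantic multi-action. -/
noncomputable def hideM (I : Set (MName Act)) (α : Multiset (MAct D Var Act)) :
    Multiset (MAct D Var Act) :=
  α.filter (fun a => a.name ∉ I)

/-- A single application of one of the communications in
`C_{Gγ} = C_γ ∪ {assignP|assignG → assign, checkP|checkG → check}` to a semantic
multi-action (data parameters must match). -/
inductive CommStep (γ : CommFun Act) :
    Multiset (MAct D Var Act) → Multiset (MAct D Var Act) → Prop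
  | act (a b c : Act) (rest : Multiset (MAct D Var Act)) : γ a b = some c →
      CommStep γ (MAct.act a ::ₘ MAct.act b ::ₘ rest) (MAct.act c ::ₘ rest)
  | assign (v : Var) (d : D) (rest : Multiset (MAct D Var Act)) :
      CommStep γ (MAct.assignP v d ::ₘ MAct.assignG v d ::ₘ rest) (MAct.assign v d ::ₘ rest)
  | check (d : D) (b : Bool) (rest : Multiset (MAct D Var Act)) :
      CommStep γ (MAct.checkP d b ::ₘ MAct.checkG d b ::ₘ rest) (MAct.check d b ::ₘ rest)

/-- `γ_{C_{Gγ}}(α) = β`: the communications are applied exhaustively to `α`, yielding `β`. -/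
def CommApply (γ : CommFun Act) (α β : Multiset (MAct D Var Act)) : Prop :=
  Relation.ReflTransGen (CommStep γ) α β ∧ ∀ β', ¬ CommStep γ β β'

/-- The structural operational semantics of the mCRL2 fragment, for a recursive
specification `mspec` assigning a defining process to every (parametrized) process name. -/
inductive MTrans {N : Type} (mspec : N → MProc D Var Act N) (γ : CommFun Act) :
    MProc D Var Act N → Multiset (MAct D Var Act) → MProc D Var Act N → Prop
  | pre (α : Multiset (MAct D Var Act)) (P : MProc D Var Act N) :
      MTrans mspec γ (.pre α P) α P
  | sumL (P Q P' : MProc D Var Act N) (α : Multiset (MAct D Var Act)) :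
      MTrans mspec γ P α P' → MTrans mspec γ (.choice P Q) α P'
  | sumR (P Q Q' : MProc D Var Act N) (α : Multiset (MAct D Var Act)) :
      MTrans mspec γ Q α Q' → MTrans mspec γ (.choice P Q) α Q'
  | name (n : N) (α : Multiset (MAct D Var Act)) (P' : MProc D Var Act N) :
      MTrans mspec γ (mspec n) α P' → MTrans mspec γ (.name n) α P'
  | parL (P Q P' : MProc D Var Act N) (α : Multiset (MAct D Var Act)) :
      MTrans mspec γ P α P' → MTrans mspec γ (.par P Q) α (.par P' Q)
  | parR (P Q Q' : MProc D Var Act N) (α : Multiset (MAct D Var Act)) :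
      MTrans mspec γ Q α Q' → MTrans mspec γ (.par P Q) α (.par P Q')
  | parC (P Q P' Q' : MProc D Var Act N) (α β : Multiset (MAct D Var Act)) :
      MTrans mspec γ P α P' → MTrans mspec γ Q β Q' →
      MTrans mspec γ (.par P Q) (α + β) (.par P' Q')
  | sum (f : D → MProc D Var Act N) (d : D) (α : Multiset (MAct D Var Act))
      (P' : MProc D Var Act N) :
      MTrans mspec γ (f d) α P' → MTrans mspec γ (.sum f) α P'
  | hide (I : Set (MName Act)) (P P' : MProc D Var Act N) (α : Multiset (MAct D Var Act)) :
      MTrans mspec γ P α P' → MTrans mspec γ (.hide I P) (hideM I α) (.hide I P')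
  | comm (P P' : MProc D Var Act N) (α β : Multiset (MAct D Var Act)) :
      MTrans mspec γ P α P' → CommApply γ α β → MTrans mspec γ (.comm P) β (.comm P')
  | allow (M : Set (Multiset (MName Act))) (P P' : MProc D Var Act N)
      (α : Multiset (MAct D Var Act)) :
      MTrans mspec γ P α P' → α.map MAct.name ∈ M →
      MTrans mspec γ (.allow M P) α (.allow M P')

/-! ## Sequential and parallel-sequential process expressions, and the translation -/

/-- Sequential process expressions (the domain of the translation `χ`). -/
inductive SeqExp (D Var Act PN : Type) : Type
  | choice : SeqExp D Var Act PN → SeqExp D Var Act PN → SeqExp D Var Act PN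
  | cond : Var → D → SeqExp D Var Act PN → SeqExp D Var Act PN
  | pre : Label D Var Act → SeqExp D Var Act PN → SeqExp D Var Act PN
  | delta : SeqExp D Var Act PN
  | name : PN → SeqExp D Var Act PN

/-- Parallel-sequential process expressions. -/
inductive ParExp (D Var Act PN : Type) : Type
  | par : ParExp D Var Act PN → ParExp D Var Act PN → ParExp D Var Act PN
  | name : PN → ParExp D Var Act PN
  | seq : SeqExp D Var Act PN → ParExp D Var Act PN

/-- The embedding of sequential expressions into process expressions. -/
def SeqExp.toPExp : SeqExp D Var Act PN → PExp D Var Act PN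
  | .choice P Q => .choice P.toPExp Q.toPExp
  | .cond v d P => .cond v d P.toPExp
  | .pre l P => .pre l P.toPExp
  | .delta => .delta
  | .name X => .name X

/-- The embedding of parallel-sequential expressions into process expressions. -/
def ParExp.toPExp : ParExp D Var Act PN → PExp D Var Act PN
  | .par P Q => .par P.toPExp Q.toPExp
  | .name X => .name X
  | .seq P => P.toPExp

/-- The translation `χ` of sequential process expressions (over the single global
variable `g`, whence `Var = Unit`), parametrized by a finite set `ε ⊆ D` of constraints. -/
def chi [DecidableEq D] : SeqExp D Unit Act PN → Finset D → MProc D Unit Act (PN ⊕ D)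
  | .choice P₁ P₂, ε => .choice (chi P₁ ε) (chi P₂ ε)
  | .cond _ d P₁, ε => chi P₁ (insert d ε)
  | .pre (.act a) P₁, ε => .sum (fun d₁ =>
      .pre {MAct.act a, MAct.checkP d₁ (decide (∀ d ∈ ε, d₁ = d))} (chi P₁ ∅))
  | .pre (.assign v d') P₁, ε => .sum (fun d₁ =>
      .pre {MAct.assignP v d', MAct.checkP d₁ (decide (∀ d ∈ ε, d₁ = d))} (chi P₁ ∅))
  | .delta, _ => .delta
  | .name X, _ => .name (Sum.inl X)

/-- The defining body of the process `Globs(d : D)` tracking the global variable `g`. -/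
def GlobsBody (d : D) : MProc D Unit Act (PN ⊕ D) :=
  .choice (.choice (.choice
    (.pre {MAct.checkG d true} (.name (Sum.inr d)))
    (.pre {MAct.checkG d true, MAct.checkG d true} (.name (Sum.inr d))))
    (.sum (fun new => .pre {MAct.checkG d true, MAct.assignG () new} (.name (Sum.inr new)))))
    (.pre {MAct.value () d} (.name (Sum.inr d)))

/-- The translated recursive specification `E'`: the translation of the defining equation
for every process name of `E`, together with a defining equation for `Globs`. -/
def mspec [DecidableEq D] (spec : PN → SeqExp D Unit Act PN) :
    PN ⊕ D → MProc D Unit Act (PN ⊕ D)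
  | Sum.inl X => chi (spec X) ∅
  | Sum.inr d => GlobsBody d

/-- The extension of `χ` to parallel-sequential process expressions. -/
def chiPar [DecidableEq D] : ParExp D Unit Act PN → MProc D Unit Act (PN ⊕ D)
  | .par P₁ P₂ => .par (chiPar P₁) (chiPar P₂)
  | .name X => .name (Sum.inl X)
  | .seq P => chi P ∅

/-- The set `A_B = (Act ∖ B) ∪ {value, assign}` of allowed multi-action names. -/
def allowSet (B : Set Act) : Set (Multiset (MName Act)) :=
  {m | (∃ a : Act, a ∉ B ∧ m = {MName.act a}) ∨ m = {MName.assign} ∨ m = {MName.value}}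

/-- The translation `Ψ(P,V) = ∇_{A_B}(τ_{{check}}(Γ_{C_{Gγ}}(χ(P,∅) ∥ Globs(V(g)))))`. -/
def Psi [DecidableEq D] (B : Set Act) (P : ParExp D Unit Act PN) (V : Valuation D Unit) :
    MProc D Unit Act (PN ⊕ D) :=
  .allow (allowSet B) (.hide {MName.check} (.comm (.par (chiPar P) (.name (Sum.inr (V ()))))))

/-- The embedding of the transition labels `TL` as semantic multi-actions. -/
def labelToM : Label D Var Act → Multiset (MAct D Var Act)
  | .act a => {MAct.act a}
  | .assign v d => {MAct.assign v d}

/-! ## Variable consistency and translation of formulas -/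

/-- Variable consistency of an LTS `(S₂, →₂, s₂)` over mCRL2 process expressions with an
LTS `(S₁, →₁, s₁)` whose states are pairs of a process expression and a valuation,
via a mapping `ℓ : S₁ → S₂`. -/
structure VarConsistent {Pr S₂ : Type}
    (tr₁ : (Pr × Valuation D Var) → Label D Var Act → (Pr × Valuation D Var) → Prop)
    (s₁ : Pr × Valuation D Var)
    (tr₂ : S₂ → Multiset (MAct D Var Act) → S₂ → Prop) (s₂ : S₂)
    (ℓ : (Pr × Valuation D Var) → S₂) : Prop where
  map_reach : ∀ s₁', ReachableState tr₁ s₁ s₁' → ReachableState tr₂ (ℓ s₁) (ℓ s₁')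
  labels : ∀ t₁ t₂ (α : Multiset (MAct D Var Act)),
    ReachableState tr₂ s₂ t₁ → ReachableState tr₂ s₂ t₂ → tr₂ t₁ α t₂ →
    (∃ l : Label D Var Act, α = labelToM l) ∨ (∃ (v : Var) (d : D), α = {MAct.value v d})
  value_loops : ∀ (P : Pr) (V : Valuation D Var) (s' : S₂) (v : Var) (d : D),
    tr₂ (ℓ (P, V)) {MAct.value v d} s' ↔ (V v = d ∧ s' = ℓ (P, V))
  steps : ∀ (l : Label D Var Act) (s₁' s₂' : Pr × Valuation D Var),
    ReachableState tr₁ s₁ s₁' → ReachableState tr₁ s₁ s₂' →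
    (tr₁ s₁' l s₂' ↔ tr₂ (ℓ s₁') (labelToM l) (ℓ s₂'))

/-- The translation `θ` of `HML^{check}` formulas into plain HML formulas: every check
`(v = e)` is replaced by `⟨value(v,e)⟩ true`. -/
def theta {L L' : Type} (f : L → L') (valL : Var → D → L') : HMLc D Var L → HMLb L'
  | .tt => .tt
  | .ff => .ff
  | .check v e => .dia {valL v e} (Set.finite_singleton _) (Set.singleton_nonempty _) .tt
  | .neg φ => .neg (theta f valL φ)
  | .conj φ ψ => .conj (theta f valL φ) (theta f valL ψ)
  | .disj φ ψ => .disj (theta f valL φ) (theta f valL ψ)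
  | .dia T hf hn φ => .dia (f '' T) (hf.image f) (hn.image f) (theta f valL φ)
  | .box T hf hn φ => .box (f '' T) (hf.image f) (hn.image f) (theta f valL φ)

/-- The recursive specification of the counterexample (no process names are needed). -/
def spec₀ : Empty → PExp (Fin 2) Unit Unit Empty := fun X => X.elim

/-- The communication function of the counterexample (no communications). -/
def γ₀ : CommFun Unit := fun _ _ => none

/-- `P = (v = 0) → a.δ`. -/
def P₀ : PExp (Fin 2) Unit Unit Empty := .cond () 0 (.pre (.act ()) .delta)

/-- `Q = a.δ`. -/
def Q₀ : PExp (Fin 2) Unit Unit Empty := .pre (.act ()) .delta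

/-- `R = assign(v,1).δ`. -/
def R₀ : PExp (Fin 2) Unit Unit Empty := .pre (.assign () 1) .delta

/-- The valuation with `V(v) = 0`. -/
def V₀ : Valuation (Fin 2) Unit := fun _ => 0

/-- A guarded expression behaves exactly like its body when the guard holds. -/
theorem trans_cond_iff [DecidableEq Var] {spec : PN → PExp D Var Act PN} {γ : CommFun Act}
    {v : Var} {d : D} {P P' : PExp D Var Act PN} {V V' : Valuation D Var}
    {l : Label D Var Act} :
    Trans spec γ (.cond v d P) V l P' V' ↔ V v = d ∧ Trans spec γ P V l P' V' := by
  constructor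
  · intro h
    cases h with
    | cond _ _ _ _ _ _ _ hv h => exact ⟨hv, h⟩
  · rintro ⟨hv, h⟩
    exact .cond _ _ _ _ _ _ _ hv h

/-- In a state where the guard holds, a guarded expression is bisimilar to its body. -/
theorem bisimilar_cond [DecidableEq Var] (spec : PN → PExp D Var Act PN) (γ : CommFun Act)
    {v : Var} {d : D} (P : PExp D Var Act PN) {V : Valuation D Var} (hv : V v = d) :
    Bisimilar (STrans spec γ) (.cond v d P, V) (P, V) := by
  refine ⟨fun s t => (s = (.cond v d P, V) ∧ t = (P, V)) ∨ s = t, ?_, .inl ⟨rfl, rfl⟩⟩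
  rintro s t (⟨rfl, rfl⟩ | rfl) l
  · exact ⟨fun s' h => ⟨s', (trans_cond_iff.1 h).2, .inr rfl⟩,
      fun t' h => ⟨t', trans_cond_iff.2 ⟨hv, h⟩, .inr rfl⟩⟩
  · exact ⟨fun s' h => ⟨s', h, .inr rfl⟩, fun t' h => ⟨t', h, .inr rfl⟩⟩

/-- An assignment step of `P₀ ∥ R₀` is the step of `R₀`. -/
theorem trans_P₀_par_R₀_assign {P' : PExp (Fin 2) Unit Unit Empty}
    {V V' : Valuation (Fin 2) Unit}
    (h : Trans spec₀ γ₀ (P₀.par R₀) V (.assign () 1) P' V') :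
    P' = P₀.par .delta ∧ V' () = 1 := by
  cases h with
  | parL _ _ _ _ _ _ h => cases (trans_cond_iff.1 h).2
  | parR _ _ _ _ _ _ h =>
    cases h
    exact ⟨rfl, Function.update_self ..⟩

/-- `P₀ ∥ δ` is stuck once the global variable is `1`. -/
theorem not_trans_P₀_par_delta {P' : PExp (Fin 2) Unit Unit Empty}
    {V V' : Valuation (Fin 2) Unit} {l : Label (Fin 2) Unit Unit} (hV : V () = 1) :
    ¬ Trans spec₀ γ₀ (P₀.par .delta) V l P' V' := by
  intro h
  cases h with
  | parL _ _ _ _ _ _ h => exact one_ne_zero (hV.symm.trans (trans_cond_iff.1 h).1)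
  | parR _ _ _ _ _ _ h => cases h
  | comm _ _ _ _ _ _ _ _ _ _ h => cases h

/-- Strong bisimilarity is not a congruence for the process algebra with global
variables: `⟨P,V⟩` and `⟨Q,V⟩` are strongly bisimilar, but `⟨P∥R,V⟩` and `⟨Q∥R,V⟩`
are not. -/
theorem statement0 :
    Bisimilar (STrans spec₀ γ₀) (P₀, V₀) (Q₀, V₀) ∧
      ¬ Bisimilar (STrans spec₀ γ₀) (P₀.par R₀, V₀) (Q₀.par R₀, V₀) := by
  refine ⟨bisimilar_cond spec₀ γ₀ Q₀ rfl, ?_⟩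
  rintro ⟨R, hR, h⟩
  obtain ⟨⟨P', V'⟩, hP, h'⟩ := (hR _ _ h (.assign () 1)).2 (Q₀.par .delta, _)
    (.parR _ _ _ _ _ _ (.asgn () 1 .delta V₀))
  obtain ⟨rfl, hV⟩ := trans_P₀_par_R₀_assign hP
  obtain ⟨s, hs, -⟩ := (hR _ _ h' (.act ())).2 (PExp.par .delta .delta, _)
    (.parL _ _ _ _ _ _ (.pref () .delta _))
  exact not_trans_P₀_par_delta hV hs

end GlobalVars
end

section
/- Let P and Q be image-finite process expressions of the process algebra with global variables. Then P and Q are stateless bisimilar if and only if for all valuations V and all HML^{check+set} formulas φ, ⟨P,V⟩ satisfies φ if and only if ⟨Q,V⟩ satisfies φ. -/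
namespace GlobalVars

open scoped Classical

variable {D Var Act PN : Type}

section HennessyMilner

variable [DecidableEq Var]

/-- Stateless bisimilar processes satisfy the same formulas in every valuation. -/
theorem IsStatelessBisim.sat_iff {spec : PN → PExp D Var Act PN} {γ : CommFun Act}
    {R : PExp D Var Act PN → PExp D Var Act PN → Prop} (hR : IsStatelessBisim spec γ R)
    (φ : HMLcs D Var (Label D Var Act)) {P Q : PExp D Var Act PN} (hPQ : R P Q)
    (V : Valuation D Var) :
    HMLcs.Sat (STrans spec γ) φ (P, V) ↔ HMLcs.Sat (STrans spec γ) φ (Q, V) := by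
  induction φ generalizing P Q V with
  | tt => exact Iff.rfl
  | ff => exact Iff.rfl
  | check v e => exact Iff.rfl
  | neg φ ih => exact not_congr (ih hPQ V)
  | conj φ ψ ihφ ihψ => exact and_congr (ihφ hPQ V) (ihψ hPQ V)
  | disj φ ψ ihφ ihψ => exact or_congr (ihφ hPQ V) (ihψ hPQ V)
  | set v e φ ih => exact ih hPQ (Function.update V v e)
  | dia T _ _ φ ih =>
    constructor
    · rintro ⟨l, hl, ⟨P', V'⟩, hstep, hsat⟩
      obtain ⟨Q', hQ', hR'⟩ := (hR P Q hPQ l V V').1 P' hstep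
      exact ⟨l, hl, (Q', V'), hQ', (ih hR' V').1 hsat⟩
    · rintro ⟨l, hl, ⟨Q', V'⟩, hstep, hsat⟩
      obtain ⟨P', hP', hR'⟩ := (hR P Q hPQ l V V').2 Q' hstep
      exact ⟨l, hl, (P', V'), hP', (ih hR' V').2 hsat⟩
  | box T _ _ φ ih =>
    constructor
    · rintro h l hl ⟨Q', V'⟩ hstep
      obtain ⟨P', hP', hR'⟩ := (hR P Q hPQ l V V').2 Q' hstep
      exact (ih hR' V').1 (h l hl (P', V') hP')
    · rintro h l hl ⟨P', V'⟩ hstep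
      obtain ⟨Q', hQ', hR'⟩ := (hR P Q hPQ l V V').1 P' hstep
      exact (ih hR' V').2 (h l hl (Q', V') hQ')

/-- When there are finitely many variables, some formula evaluates `φ` in a fixed valuation `W`,
independently of the current one. -/
theorem HMLcs.exists_sat_iff_at_valuation [Finite Var] {Pr L : Type}
    (tr : (Pr × Valuation D Var) → L → (Pr × Valuation D Var) → Prop)
    (φ : HMLcs D Var L) (W : Valuation D Var) :
    ∃ ψ : HMLcs D Var L, ∀ P V, HMLcs.Sat tr ψ (P, V) ↔ HMLcs.Sat tr φ (P, W) := by
  have key : ∀ S : Set Var, S.Finite → ∃ ψ : HMLcs D Var L, ∀ P V, (∀ v ∉ S, V v = W v) →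
      (HMLcs.Sat tr ψ (P, V) ↔ HMLcs.Sat tr φ (P, W)) := by
    intro S hS
    induction S, hS using Set.Finite.induction_on with
    | empty =>
      refine ⟨φ, fun P V hV => ?_⟩
      rw [show V = W from funext fun v => hV v (Set.notMem_empty v)]
    | @insert w S _ _ ih =>
      obtain ⟨ψ, hψ⟩ := ih
      refine ⟨.set w (W w) ψ, fun P V hV => hψ P (Function.update V w (W w)) fun v hv => ?_⟩
      by_cases hvw : v = w
      · subst hvw
        simp
      · rw [Function.update_of_ne hvw]
        exact hV v (by simp [hvw, hv])
  obtain ⟨ψ, hψ⟩ := key Set.univ Set.finite_univ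
  exact ⟨ψ, fun P V => hψ P V fun v hv => (hv (Set.mem_univ v)).elim⟩

/-- A state that can be distinguished from each state of a finite set can be distinguished from
all of them by a single formula. -/
theorem HMLcs.exists_sat_forall_not_sat {Pr L : Type}
    (tr : (Pr × Valuation D Var) → L → (Pr × Valuation D Var) → Prop)
    (s : Pr × Valuation D Var) {S : Set (Pr × Valuation D Var)} (hS : S.Finite)
    (h : ∀ t ∈ S, ∃ φ : HMLcs D Var L, HMLcs.Sat tr φ s ∧ ¬ HMLcs.Sat tr φ t) :
    ∃ φ : HMLcs D Var L, HMLcs.Sat tr φ s ∧ ∀ t ∈ S, ¬ HMLcs.Sat tr φ t := by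
  induction S, hS using Set.Finite.induction_on with
  | empty => exact ⟨.tt, trivial, fun t ht => ht.elim⟩
  | @insert a S _ _ ih =>
    obtain ⟨φ, hφs, hφ⟩ := ih fun t ht => h t (Set.mem_insert_of_mem a ht)
    obtain ⟨ψ, hψs, hψ⟩ := h a (Set.mem_insert a S)
    refine ⟨.conj φ ψ, ⟨hφs, hψs⟩, ?_⟩
    rintro t (rfl | ht) ⟨h₁, h₂⟩
    · exact hψ h₂
    · exact hφ t ht h₁

/-- Two processes satisfy the same formulas in every valuation. -/
def LogicallyEquivalent (spec : PN → PExp D Var Act PN) (γ : CommFun Act)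
    (P Q : PExp D Var Act PN) : Prop :=
  ∀ (V : Valuation D Var) (φ : HMLcs D Var (Label D Var Act)),
    HMLcs.Sat (STrans spec γ) φ (P, V) ↔ HMLcs.Sat (STrans spec γ) φ (Q, V)

theorem LogicallyEquivalent.symm {spec : PN → PExp D Var Act PN} {γ : CommFun Act}
    {P Q : PExp D Var Act PN} (h : LogicallyEquivalent spec γ P Q) :
    LogicallyEquivalent spec γ Q P :=
  fun V φ => (h V φ).symm

/-- Processes that are not logically equivalent are distinguished by a single formula, whatever
the current valuations. -/
theorem exists_sat_not_sat_of_not_logicallyEquivalent [Finite Var]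
    {spec : PN → PExp D Var Act PN} {γ : CommFun Act} {P Q : PExp D Var Act PN}
    (h : ¬ LogicallyEquivalent spec γ P Q) :
    ∃ φ : HMLcs D Var (Label D Var Act), ∀ V V' : Valuation D Var,
      HMLcs.Sat (STrans spec γ) φ (P, V) ∧ ¬ HMLcs.Sat (STrans spec γ) φ (Q, V') := by
  simp only [LogicallyEquivalent, not_forall] at h
  obtain ⟨W, φ, hφ⟩ := h
  obtain ⟨ψ, hψ⟩ := HMLcs.exists_sat_iff_at_valuation (STrans spec γ) φ W
  by_cases hP : HMLcs.Sat (STrans spec γ) φ (P, W)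
  · exact ⟨ψ, fun V V' => ⟨(hψ P V).2 hP, fun hQ => hφ (iff_of_true hP ((hψ Q V').1 hQ))⟩⟩
  · exact ⟨.neg ψ, fun V V' => ⟨fun hP' => hP ((hψ P V).1 hP'),
      fun hQ => hQ ((hψ Q V').2 (by_contra fun hQ' => hφ (iff_of_false hP hQ')))⟩⟩

/-- A transition of a process is matched by every logically equivalent process whose states are
image-finite. -/
theorem LogicallyEquivalent.exists_trans [Finite Var]
    {spec : PN → PExp D Var Act PN} {γ : CommFun Act} {P Q : PExp D Var Act PN}
    (h : LogicallyEquivalent spec γ P Q) {V V' : Valuation D Var} {l : Label D Var Act}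
    (hQ : ImageFiniteState (STrans spec γ) (Q, V)) {P' : PExp D Var Act PN}
    (hstep : Trans spec γ P V l P' V') :
    ∃ Q', Trans spec γ Q V l Q' V' ∧ LogicallyEquivalent spec γ P' Q' := by
  by_contra! hno
  obtain ⟨φ, hφ, hφQ⟩ := HMLcs.exists_sat_forall_not_sat (STrans spec γ) (P', V') (hQ l) (by
    rintro ⟨Q', V''⟩ hstep'
    by_cases hV : V'' = V'
    · subst hV
      obtain ⟨φ, hφ⟩ := exists_sat_not_sat_of_not_logicallyEquivalent (hno Q' hstep')
      exact ⟨φ, hφ V'' V''⟩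
    · obtain ⟨v, hv⟩ := Function.ne_iff.1 hV
      exact ⟨.check v (V' v), rfl, hv⟩)
  obtain ⟨l', rfl, t, ht, hsat⟩ :=
    (h V (.dia {l} (Set.finite_singleton l) (Set.singleton_nonempty l) φ)).1
      ⟨l, rfl, (P', V'), hstep, hφ⟩
  exact hφQ t ht hsat

theorem ImageFiniteProc.of_trans {spec : PN → PExp D Var Act PN} {γ : CommFun Act}
    {P P' : PExp D Var Act PN} (h : ImageFiniteProc spec γ P) {V V' : Valuation D Var}
    {l : Label D Var Act} (hstep : Trans spec γ P V l P' V') : ImageFiniteProc spec γ P' :=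
  fun P'' hP'' => h P'' (hP''.head ⟨V, l, V', hstep⟩)

/-- Logical equivalence of image-finite processes is a stateless bisimulation. -/
theorem isStatelessBisim_logicallyEquivalent [Finite Var] (spec : PN → PExp D Var Act PN)
    (γ : CommFun Act) :
    IsStatelessBisim spec γ fun P Q =>
      ImageFiniteProc spec γ P ∧ ImageFiniteProc spec γ Q ∧ LogicallyEquivalent spec γ P Q := by
  rintro P Q ⟨hP, hQ, h⟩ l V V'
  constructor
  · intro P' hstep
    obtain ⟨Q', hQ', h'⟩ := h.exists_trans (hQ Q .refl V) hstep
    exact ⟨Q', hQ', hP.of_trans hstep, hQ.of_trans hQ', h'⟩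
  · intro Q' hstep
    obtain ⟨P', hP', h'⟩ := h.symm.exists_trans (hP P .refl V) hstep
    exact ⟨P', hP', hP.of_trans hP', hQ.of_trans hstep, h'.symm⟩

end HennessyMilner

/-- Theorem 1: for image-finite process expressions `P` and `Q`, `P` and `Q` are
stateless bisimilar iff for all valuations `V` and all `HML^{check+set}` formulas `φ`,
`⟨P,V⟩ ⊨ φ ↔ ⟨Q,V⟩ ⊨ φ`. -/
theorem statement1 {D Var Act PN : Type} [DecidableEq Var] [Finite Var]
    (spec : PN → PExp D Var Act PN) (hspec : Guarded spec)
    (γ : CommFun Act) (hγc : CommFun.Commutative γ) (hγa : CommFun.Associative γ)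
    (hγh : CommFun.Handshaking γ)
    (P Q : PExp D Var Act PN)
    (hP : ImageFiniteProc spec γ P) (hQ : ImageFiniteProc spec γ Q) :
    StatelessBisimilar spec γ P Q ↔
      ∀ (V : Valuation D Var) (φ : HMLcs D Var (Label D Var Act)),
        HMLcs.Sat (STrans spec γ) φ (P, V) ↔ HMLcs.Sat (STrans spec γ) φ (Q, V) := by
  constructor
  · rintro ⟨R, hR, hPQ⟩ V φ
    exact hR.sat_iff φ hPQ V
  · intro h
    exact ⟨_, isStatelessBisim_logicallyEquivalent spec γ, hP, hQ, h⟩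

end GlobalVars
end

section
/- If two states ⟨P,V1⟩ and ⟨Q,V2⟩ of the process algebra with global variables are state-based bisimilar, then they satisfy exactly the same HML^{check} formulas. -/
namespace GlobalVars

open scoped Classical

variable {D Var Act PN : Type}

/-- The states related by a state-based bisimulation satisfy the same `HML^{check}` formulas. -/
theorem IsStateBasedBisim.sat_iff [DecidableEq Var] {spec : PN → PExp D Var Act PN}
    {γ : CommFun Act} {R : GState D Var Act PN → GState D Var Act PN → Prop}
    (hR : IsStateBasedBisim spec γ R) (φ : HMLc D Var (Label D Var Act)) :
    ∀ {s t : GState D Var Act PN}, R s t →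
      (HMLc.Sat (STrans spec γ) φ s ↔ HMLc.Sat (STrans spec γ) φ t) := by
  induction φ with
  | tt => exact fun _ => Iff.rfl
  | ff => exact fun _ => Iff.rfl
  | check v e =>
    rintro ⟨P, V₁⟩ ⟨Q, V₂⟩ h
    obtain ⟨rfl, -⟩ := hR P V₁ Q V₂ h
    exact Iff.rfl
  | neg φ ih => exact fun h => not_congr (ih h)
  | conj φ ψ ihφ ihψ => exact fun h => and_congr (ihφ h) (ihψ h)
  | disj φ ψ ihφ ihψ => exact fun h => or_congr (ihφ h) (ihψ h)
  | dia T _ _ φ ih =>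
    rintro ⟨P, V₁⟩ ⟨Q, V₂⟩ h
    have hstep := (hR P V₁ Q V₂ h).2
    constructor
    · rintro ⟨l, hl, ⟨P', V'⟩, htr, hsat⟩
      obtain ⟨Q', htr', h'⟩ := (hstep l V').1 P' htr
      exact ⟨l, hl, (Q', V'), htr', (ih h').1 hsat⟩
    · rintro ⟨l, hl, ⟨Q', V'⟩, htr, hsat⟩
      obtain ⟨P', htr', h'⟩ := (hstep l V').2 Q' htr
      exact ⟨l, hl, (P', V'), htr', (ih h').2 hsat⟩
  | box T _ _ φ ih =>
    rintro ⟨P, V₁⟩ ⟨Q, V₂⟩ h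
    have hstep := (hR P V₁ Q V₂ h).2
    constructor
    · rintro hsat l hl ⟨Q', V'⟩ htr
      obtain ⟨P', htr', h'⟩ := (hstep l V').2 Q' htr
      exact (ih h').1 (hsat l hl (P', V') htr')
    · rintro hsat l hl ⟨P', V'⟩ htr
      obtain ⟨Q', htr', h'⟩ := (hstep l V').1 P' htr
      exact (ih h').2 (hsat l hl (Q', V') htr')

/-- State-based bisimilar states satisfy exactly the same `HML^{check}` formulas. -/
theorem statement5 {D Var Act PN : Type} [DecidableEq Var] [Finite Var]
    (spec : PN → PExp D Var Act PN) (hspec : Guarded spec)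
    (γ : CommFun Act) (hγc : CommFun.Commutative γ) (hγa : CommFun.Associative γ)
    (hγh : CommFun.Handshaking γ)
    (P Q : PExp D Var Act PN) (V₁ V₂ : Valuation D Var)
    (h : StateBasedBisimilar spec γ (P, V₁) (Q, V₂)) :
    ∀ φ : HMLc D Var (Label D Var Act),
      HMLc.Sat (STrans spec γ) φ (P, V₁) ↔ HMLc.Sat (STrans spec γ) φ (Q, V₂) := by
  obtain ⟨R, hR, hPQ⟩ := h
  exact fun φ => hR.sat_iff φ hPQ

end GlobalVars
end
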